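/- Let (Ω, F, P) be a non-atomic probability space and let ρ : L^∞(P) → ℝ be a law-invariant bounded linear functional, i.e., ρ(X) = ρ(X') whenever X, X' ∈ L^∞(P) satisfy X ~ X'. Then ρ(X) = ρ(1)·E[X] for every X ∈ L^∞(P). -/

import Mathlib

open MeasureTheory ProbabilityTheory
open scoped ENNReal

/-- A measure is nonatomic if every measurable set of positive measure admits a measurable
subset of strictly smaller positive measure. -/
def Nonatomic {Ω : Type*} [MeasurableSpace Ω] (μ : Measure Ω) : Prop :=
  ∀ s : Set Ω, MeasurableSet s → 0 < μ s →
    ∃ t, t ⊆ s ∧ MeasurableSet t ∧ 0 < μ t ∧ μ t < μ s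

/-- A nonempty bounded-above family has a member whose value is at least halfway from that of a
given member to the supremum. -/
theorem exists_forall_add_le_two_mul {α : Type*} (m : α → ℝ) (p : α → Prop)
    (hm : ∃ C, ∀ b, p b → m b ≤ C) {a : α} (ha : p a) :
    ∃ b, p b ∧ ∀ b', p b' → m b' + m a ≤ 2 * m b := by
  obtain ⟨C, hC⟩ := hm
  have hbdd : BddAbove (m '' {b | p b}) := ⟨C, by rintro _ ⟨b, hb, rfl⟩; exact hC b hb⟩
  have hle : ∀ b, p b → m b ≤ sSup (m '' {b | p b}) := fun b hb => le_csSup hbdd ⟨b, hb, rfl⟩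
  rcases (hle a ha).eq_or_lt with h | h
  · exact ⟨a, ha, fun b' hb' => by linarith [hle b' hb']⟩
  · obtain ⟨_, ⟨b, hb, rfl⟩, hlt⟩ := exists_lt_of_lt_csSup (s := m '' {b | p b}) ⟨m a, a, ha, rfl⟩
      (show (m a + sSup (m '' {b | p b})) / 2 < sSup (m '' {b | p b}) by linarith)
    exact ⟨b, hb, fun b' hb' => by linarith [hle b' hb']⟩

/-- A nonempty family of sets closed under increasing countable unions has a member that cannot be
enlarged in measure within the family. -/
theorem exists_forall_measureReal_le {Ω : Type*} [MeasurableSpace Ω] (μ : Measure Ω)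
    [IsFiniteMeasure μ] (F : Set Ω → Prop)
    (hF : ∀ A : ℕ → Set Ω, Monotone A → (∀ n, F (A n)) → F (⋃ n, A n))
    {A₀ : Set Ω} (hA₀ : F A₀) :
    ∃ A, F A ∧ ∀ B, A ⊆ B → F B → μ.real B ≤ μ.real A := by
  have step (A : {A // F A}) : ∃ B : {B // F B}, A.1 ⊆ B.1 ∧
      ∀ B', A.1 ⊆ B' → F B' → μ.real B' + μ.real A.1 ≤ 2 * μ.real B.1 := by
    obtain ⟨B, ⟨hAB, hB⟩, h⟩ := exists_forall_add_le_two_mul μ.real (fun B => A.1 ⊆ B ∧ F B)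
      ⟨μ.real Set.univ, fun _ _ => measureReal_mono (Set.subset_univ _)⟩ ⟨subset_rfl, A.2⟩
    exact ⟨⟨B, hB⟩, hAB, fun B' h₁ h₂ => h B' ⟨h₁, h₂⟩⟩
  choose next hsub hnext using step
  let A : ℕ → {A // F A} := fun n => next^[n] ⟨A₀, hA₀⟩
  have hsucc (n : ℕ) : A (n + 1) = next (A n) := Function.iterate_succ_apply' _ _ _
  have hmono : Monotone fun n => (A n).1 :=
    monotone_nat_of_le_succ fun n => by rw [hsucc]; exact hsub _
  refine ⟨⋃ n, (A n).1, hF _ hmono fun n => (A n).2, fun B hAB hB => ?_⟩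
  have hlim : Filter.Tendsto (fun n => μ.real (A n).1) Filter.atTop
      (nhds (μ.real (⋃ n, (A n).1))) :=
    (ENNReal.tendsto_toReal (measure_ne_top _ _)).comp (tendsto_measure_iUnion_atTop hmono)
  have h := le_of_tendsto_of_tendsto' (hlim.const_add (μ.real B))
    (((Filter.tendsto_add_atTop_iff_nat 1).2 hlim).const_mul 2) fun n => by
      rw [hsucc]
      exact hnext _ B ((Set.subset_iUnion (fun n => (A n).1) n).trans hAB) hB
  linarith

theorem Nonatomic.exists_subset_measureReal_le {Ω : Type*} [MeasurableSpace Ω] {μ : Measure Ω}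
    [IsFiniteMeasure μ] (hμ : Nonatomic μ) {s : Set Ω} (hs : MeasurableSet s)
    (hpos : 0 < μ.real s) {ε : ℝ} (hε : 0 < ε) :
    ∃ t, t ⊆ s ∧ MeasurableSet t ∧ 0 < μ.real t ∧ μ.real t ≤ ε := by
  have halves (n : ℕ) : ∃ t, t ⊆ s ∧ MeasurableSet t ∧ 0 < μ.real t ∧
      μ.real t ≤ (1 / 2) ^ n * μ.real s := by
    induction n with
    | zero => exact ⟨s, subset_rfl, hs, hpos, by simp⟩
    | succ n ih =>
      obtain ⟨t, hts, ht, ht0, htle⟩ := ih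
      obtain ⟨u, hut, hu, hu0, hlt⟩ := hμ t ht (ENNReal.toReal_pos_iff.1 ht0).1
      have hu0' : 0 < μ.real u := ENNReal.toReal_pos hu0.ne' (measure_ne_top _ _)
      have hlt' : μ.real u < μ.real t :=
        (ENNReal.toReal_lt_toReal (measure_ne_top _ _) (measure_ne_top _ _)).2 hlt
      have hdiff : μ.real (t \ u) = μ.real t - μ.real u := measureReal_sdiff hut hu
      rw [pow_succ]
      rcases le_total (μ.real u) (μ.real t / 2) with h | h
      · exact ⟨u, hut.trans hts, hu, hu0', by linarith⟩
      · exact ⟨t \ u, Set.sdiff_subset.trans hts, ht.diff hu, by linarith, by linarith⟩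
  obtain ⟨n, hn⟩ := exists_pow_lt_of_lt_one (div_pos hε hpos) (by norm_num : (1 / 2 : ℝ) < 1)
  obtain ⟨t, hts, ht, ht0, htle⟩ := halves n
  exact ⟨t, hts, ht, ht0, htle.trans ((lt_div_iff₀ hpos).1 hn).le⟩

/-- **Sierpiński's theorem**: a finite nonatomic measure takes all intermediate values on the
measurable subsets of a measurable set. -/
theorem Nonatomic.exists_subset_measureReal_eq {Ω : Type*} [MeasurableSpace Ω] {μ : Measure Ω}
    [IsFiniteMeasure μ] (hμ : Nonatomic μ) {s : Set Ω} (hs : MeasurableSet s) {c : ℝ}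
    (hc : 0 ≤ c) (hcs : c ≤ μ.real s) :
    ∃ t, t ⊆ s ∧ MeasurableSet t ∧ μ.real t = c := by
  obtain ⟨t, ⟨hts, ht, htc⟩, hmax⟩ := exists_forall_measureReal_le μ
    (fun t => t ⊆ s ∧ MeasurableSet t ∧ μ.real t ≤ c)
    (fun A hA h => ⟨Set.iUnion_subset fun n => (h n).1, .iUnion fun n => (h n).2.1,
      le_of_tendsto' ((ENNReal.tendsto_toReal (measure_ne_top _ _)).comp
        (tendsto_measure_iUnion_atTop hA)) fun n => (h n).2.2⟩)
    (A₀ := ∅) ⟨Set.empty_subset _, .empty, by simpa using hc⟩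
  refine ⟨t, hts, ht, htc.antisymm (not_lt.1 fun hlt => ?_)⟩
  have hdiff : μ.real (s \ t) = μ.real s - μ.real t := measureReal_sdiff hts ht
  obtain ⟨u, hus, hu, hu0, huc⟩ := hμ.exists_subset_measureReal_le (hs.diff ht)
    (by linarith) (sub_pos.2 hlt)
  have hunion : μ.real (t ∪ u) = μ.real t + μ.real u :=
    measureReal_union (Set.disjoint_sdiff_right.mono_right hus) hu
  have := hmax (t ∪ u) Set.subset_union_left
    ⟨Set.union_subset hts (hus.trans Set.sdiff_subset), ht.union hu, by linarith⟩
  linarith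

theorem identDistrib_indicator_const {Ω : Type*} [MeasurableSpace Ω] {μ : Measure Ω}
    [IsFiniteMeasure μ] {s t : Set Ω} (hs : MeasurableSet s) (ht : MeasurableSet t)
    (h : μ s = μ t) (c : ℝ) :
    IdentDistrib (s.indicator fun _ => c) (t.indicator fun _ => c) μ μ where
  aemeasurable_fst := (measurable_const.indicator hs).aemeasurable
  aemeasurable_snd := (measurable_const.indicator ht).aemeasurable
  map_eq := by
    classical
    ext u hu
    rw [Measure.map_apply (measurable_const.indicator hs) hu,
      Measure.map_apply (measurable_const.indicator ht) hu,
      Set.indicator_const_preimage_eq_union, Set.indicator_const_preimage_eq_union]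
    have hcompl : μ sᶜ = μ tᶜ := by
      rw [measure_compl hs (measure_ne_top _ _), measure_compl ht (measure_ne_top _ _), h]
    by_cases h1 : c ∈ u <;> by_cases h0 : (0 : ℝ) ∈ u <;> simp [h1, h0, h, hcompl]

theorem MeasureTheory.Lp.ae_norm_apply_le_norm {Ω : Type*} [MeasurableSpace Ω] {μ : Measure Ω}
    (X : Lp ℝ ⊤ μ) : ∀ᵐ ω ∂μ, ‖X ω‖ ≤ ‖X‖ := by
  filter_upwards [ae_le_eLpNormEssSup (f := X) (μ := μ)] with ω hω
  rw [Lp.norm_def, eLpNorm_exponent_top, ← toReal_enorm]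
  refine ENNReal.toReal_mono ?_ hω
  rw [← eLpNorm_exponent_top]
  exact Lp.eLpNorm_ne_top X

theorem MeasureTheory.Lp.exists_simpleFunc_ae_norm_sub_le {Ω : Type*} [MeasurableSpace Ω]
    {μ : Measure Ω}
    (X : Lp ℝ ⊤ μ) {ε : ℝ} (hε : 0 < ε) :
    ∃ g : SimpleFunc Ω ℝ, ∀ᵐ ω ∂μ, ‖X ω - g ω‖ ≤ ε := by
  let N : ℤ := ⌈‖X‖ / ε⌉
  let k : Ω → ℤ := fun ω => max (-N) (min N ⌊X ω / ε⌋)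
  have hN : 0 ≤ N := Int.ceil_nonneg (by positivity)
  have hX : Measurable X := (Lp.stronglyMeasurable X).measurable
  have hk : Measurable k :=
    measurable_const.max (measurable_const.min (hX.div_const ε).floor)
  have hfin : (Set.range k).Finite := (Set.finite_Icc (-N) N).subset <| by
    rintro _ ⟨ω, rfl⟩
    exact ⟨le_max_left _ _, max_le (by lia) (min_le_left _ _)⟩
  let K : SimpleFunc Ω ℤ := ⟨k, fun _ => hk (measurableSet_singleton _), hfin⟩
  refine ⟨K.map fun j : ℤ => ε * (j : ℝ), ?_⟩
  filter_upwards [Lp.ae_norm_apply_le_norm X] with ω hω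
  have hle : |X ω / ε| ≤ N := by
    rw [abs_div, abs_of_pos hε]
    exact (div_le_div_of_nonneg_right hω hε.le).trans (Int.le_ceil _)
  rw [abs_le] at hle
  have hlow : -N ≤ ⌊X ω / ε⌋ := Int.le_floor.2 (by push_cast; exact hle.1)
  have hup : ⌊X ω / ε⌋ ≤ N := by
    exact_mod_cast (Int.floor_le _).trans hle.2
  have hkω : K ω = ⌊X ω / ε⌋ := by
    change max (-N) (min N ⌊X ω / ε⌋) = _
    rw [min_eq_right hup, max_eq_right hlow]
  have h1 := Int.floor_le (X ω / ε)
  have h2 := (Int.lt_floor_add_one (X ω / ε)).le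
  rw [le_div_iff₀ hε] at h1
  rw [div_le_iff₀ hε] at h2
  rw [SimpleFunc.map_apply, hkω, Real.norm_eq_abs, abs_le]
  constructor <;> linarith

/-- A continuous linear functional on `L^∞` vanishing on all indicator functions is zero. -/
theorem eq_zero_of_apply_indicatorConstLp_eq_zero {Ω : Type*} [MeasurableSpace Ω] {μ : Measure Ω}
    [IsProbabilityMeasure μ] (D : Lp ℝ ⊤ μ →L[ℝ] ℝ)
    (hD : ∀ (s : Set Ω) (hs : MeasurableSet s),
      D (indicatorConstLp ⊤ hs (measure_ne_top μ s) (1 : ℝ)) = 0) :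
    D = 0 := by
  have hsimple (g : SimpleFunc Ω ℝ) (hg : MemLp g ⊤ μ) : D (hg.toLp g) = 0 := by
    induction g using SimpleFunc.induction with
    | const c hs =>
      have : hg.toLp _ = c • indicatorConstLp ⊤ hs (measure_ne_top μ _) (1 : ℝ) := by
        rw [indicatorConstLp, ← MemLp.toLp_const_smul]
        refine MemLp.toLp_congr _ _ (.of_forall fun ω => ?_)
        simp [Set.piecewise, Set.indicator]
      rw [this, map_smul, hD, smul_zero]
    | @add f g _ hf' hg' =>
      have hfm := f.memLp_of_isFiniteMeasure ⊤ μ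
      have hgm := g.memLp_of_isFiniteMeasure ⊤ μ
      have : hg.toLp _ = hfm.toLp f + hgm.toLp g := MemLp.toLp_add hfm hgm
      rw [this, map_add, hf' hfm, hg' hgm, add_zero]
  ext X
  refine norm_le_zero_iff.1 (le_of_forall_pos_le_add fun ε hε => ?_)
  obtain ⟨g, hg⟩ := Lp.exists_simpleFunc_ae_norm_sub_le X
    (ε := ε / (‖D‖ + 1)) (by positivity)
  have hgm := g.memLp_of_isFiniteMeasure ⊤ μ
  have hnorm : ‖X - hgm.toLp g‖ ≤ ε / (‖D‖ + 1) := by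
    have := Lp.norm_le_of_ae_bound (f := X - hgm.toLp g) (C := ε / (‖D‖ + 1)) (by positivity) <| by
      filter_upwards [hg, Lp.coeFn_sub X (hgm.toLp g), hgm.coeFn_toLp] with ω h1 h2 h3
      rwa [h2, Pi.sub_apply, h3]
    simpa using this
  calc ‖D X‖ = ‖D (X - hgm.toLp g)‖ := by rw [map_sub, hsimple, sub_zero]
    _ ≤ ‖D‖ * (ε / (‖D‖ + 1)) := D.le_opNorm_of_le hnorm
    _ ≤ (‖D‖ + 1) * (ε / (‖D‖ + 1)) := by gcongr; linarith
    _ = 0 + ε := by field_simp; ring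

/-- A law-invariant functional on `L^∞` that vanishes at the constant `1` vanishes at all
indicator functions. -/
theorem Nonatomic.apply_indicatorConstLp_eq_zero {Ω : Type*} [MeasurableSpace Ω] {P : Measure Ω}
    [IsProbabilityMeasure P] (hP : Nonatomic P) (D : Lp ℝ ⊤ P →L[ℝ] ℝ)
    (hD : ∀ X X' : Lp ℝ ⊤ P, IdentDistrib (X : Ω → ℝ) (X' : Ω → ℝ) P P → D X = D X')
    (hD1 : D (Lp.const ⊤ P (1 : ℝ)) = 0) (s : Set Ω) (hs : MeasurableSet s) :
    D (indicatorConstLp ⊤ hs (measure_ne_top P s) (1 : ℝ)) = 0 := by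
  let d (A : {A : Set Ω // MeasurableSet A}) : ℝ :=
    D (indicatorConstLp ⊤ A.2 (measure_ne_top P A.1) (1 : ℝ))
  have hlaw (A B : {A : Set Ω // MeasurableSet A}) (h : P.real A.1 = P.real B.1) :
      d A = d B := by
    have hA := indicatorConstLp_coeFn (p := ⊤) (hs := A.2)
      (hμs := measure_ne_top P A.1) (c := (1 : ℝ))
    have hB := indicatorConstLp_coeFn (p := ⊤) (hs := B.2)
      (hμs := measure_ne_top P B.1) (c := (1 : ℝ))
    exact hD _ _ <| (IdentDistrib.of_ae_eq (Lp.stronglyMeasurable _).measurable.aemeasurable hA).trans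
      <| (identDistrib_indicator_const A.2 B.2
        ((ENNReal.toReal_eq_toReal_iff' (measure_ne_top _ _) (measure_ne_top _ _)).1 h) 1).trans
      (IdentDistrib.of_ae_eq (Lp.stronglyMeasurable _).measurable.aemeasurable hB).symm
  have hadd (A B : {A : Set Ω // MeasurableSet A}) (h : Disjoint A.1 B.1) :
      d ⟨A.1 ∪ B.1, A.2.union B.2⟩ = d A + d B := by
    simp only [d, indicatorConstLp_disjoint_union A.2 B.2 (measure_ne_top _ _)
      (measure_ne_top _ _) h, map_add]
  have hcompl (A : {A : Set Ω // MeasurableSet A}) : d ⟨A.1ᶜ, A.2.compl⟩ = -d A := by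
    have h := hadd A ⟨A.1ᶜ, A.2.compl⟩ disjoint_compl_right
    have huniv : d ⟨A.1 ∪ A.1ᶜ, A.2.union A.2.compl⟩ = 0 := by
      simp only [d, Set.union_compl_self, indicatorConstLp_univ, hD1]
    linarith
  have hdouble (A : {A : Set Ω // MeasurableSet A}) (h : P.real A.1 ≤ 1 / 2) :
      ∃ B, d B = 2 * d A := by
    have hc : P.real A.1ᶜ = 1 - P.real A.1 := probReal_compl_eq_one_sub A.2
    obtain ⟨t, htA, ht, hPt⟩ := hP.exists_subset_measureReal_eq A.2.compl measureReal_nonneg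
      (show P.real A.1 ≤ P.real A.1ᶜ by linarith)
    refine ⟨_, (hadd A ⟨t, ht⟩ (Set.disjoint_left.2 fun ω hA hω => htA hω hA)).trans ?_⟩
    rw [hlaw ⟨t, ht⟩ A hPt]
    ring
  have hdouble_abs (A : {A : Set Ω // MeasurableSet A}) : ∃ B, |d B| = 2 * |d A| := by
    rcases le_total (P.real A.1) (1 / 2) with h | h
    · obtain ⟨B, hB⟩ := hdouble A h
      exact ⟨B, by rw [hB, abs_mul, abs_two]⟩
    · obtain ⟨B, hB⟩ := hdouble ⟨A.1ᶜ, A.2.compl⟩ (by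
        have : P.real A.1ᶜ = 1 - P.real A.1 := probReal_compl_eq_one_sub A.2
        linarith)
      exact ⟨B, by rw [hB, hcompl, abs_mul, abs_two, abs_neg]⟩
  have hbound (A : {A : Set Ω // MeasurableSet A}) : |d A| ≤ ‖D‖ := by
    have h := norm_indicatorConstLp_le (p := ⊤) (hs := A.2) (hμs := measure_ne_top P A.1)
      (c := (1 : ℝ))
    simpa using D.le_opNorm_of_le h
  obtain ⟨A, -, hA⟩ := exists_forall_add_le_two_mul (fun A => |d A|) (fun _ => True)
    ⟨‖D‖, fun A _ => hbound A⟩ (a := ⟨s, hs⟩) trivial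
  obtain ⟨B, hB⟩ := hdouble_abs A
  have := hA B trivial
  exact abs_nonpos_iff.1 (show |d ⟨s, hs⟩| ≤ 0 by linarith)

/-- The integral is a continuous linear functional on `L^∞`. -/
theorem exists_continuousLinearMap_eq_integral {Ω : Type*} [MeasurableSpace Ω] (μ : Measure Ω)
    [IsFiniteMeasure μ] :
    ∃ L : Lp ℝ ⊤ μ →L[ℝ] ℝ, ∀ X : Lp ℝ ⊤ μ, L X = ∫ ω, X ω ∂μ := by
  have hinteg (X : Lp ℝ ⊤ μ) : Integrable X μ := (Lp.memLp X).integrable le_top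
  let L : Lp ℝ ⊤ μ →ₗ[ℝ] ℝ :=
    { toFun := fun X => ∫ ω, X ω ∂μ
      map_add' := fun X Y => by
        rw [integral_congr_ae (Lp.coeFn_add X Y)]
        exact integral_add (hinteg X) (hinteg Y)
      map_smul' := fun c X => by
        rw [integral_congr_ae (Lp.coeFn_smul c X)]
        exact integral_smul c X }
  exact ⟨L.mkContinuous (μ.real Set.univ) fun X => by
    rw [mul_comm]
    exact norm_integral_le_of_norm_le_const (Lp.ae_norm_apply_le_norm X), fun X => rfl⟩

/-- Every law-invariant bounded linear functional on `L^∞` over a non-atomic probability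
space collapses to the mean: `ρ(X) = ρ(1)·E[X]`. -/
theorem lawInvariant_functional_Linfty_collapses_to_mean
    {Ω : Type*} [MeasurableSpace Ω] (P : Measure Ω) [IsProbabilityMeasure P]
    (hP : Nonatomic P) (ρ : Lp ℝ ⊤ P →L[ℝ] ℝ)
    (hρ : ∀ X X' : Lp ℝ ⊤ P, IdentDistrib (X : Ω → ℝ) (X' : Ω → ℝ) P P → ρ X = ρ X') :
    ∀ X : Lp ℝ ⊤ P, ρ X = ρ (Lp.const ⊤ P (1 : ℝ)) * ∫ ω, X ω ∂P := by
  obtain ⟨L, hL⟩ := exists_continuousLinearMap_eq_integral P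
  have hL1 : L (Lp.const ⊤ P (1 : ℝ)) = 1 := by
    rw [hL, integral_congr_ae (Lp.coeFn_const (p := ⊤) (μ := P) (c := (1 : ℝ)))]
    simp
  have hzero : ρ - ρ (Lp.const ⊤ P (1 : ℝ)) • L = 0 :=
    eq_zero_of_apply_indicatorConstLp_eq_zero _ <| hP.apply_indicatorConstLp_eq_zero _
      (fun X X' h => by simp [hρ X X' h, hL, h.integral_eq]) (by simp [hL1])
  intro X
  have hX := DFunLike.congr_fun hzero X
  simp only [sub_apply, smul_apply, hL, smul_eq_mul, zero_apply] at hX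
  exact sub_eq_zero.1 hX
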